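/- arXiv:math/0305226 — 2 statements merged into one kernel-verified Lean document; each statement's English description precedes it below -/
import Mathlib

section
/- Let X be a smooth complete curve over a field K, and let s be a section of the canonical projection pr_{X/K} : G_{K(X)} → G_K. If s(G_K) is contained in a decomposition subgroup D_P of G_{K(X)} with respect to some point P ∈ X(K̄), then P ∈ X(K^perf) and s(G_K) is a complement of the inertia subgroup of D_P in D_P; in particular s is geometric. -/
open Polynomial
namespace SecGeo

theorem lt_one_iff {L : Type*} [Field L] (A : ValuationSubring L) (x : L) :
    A.valuation x < 1 ↔ x = 0 ∨ x⁻¹ ∉ A := by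
  by_cases h : x = 0
  · simp [h]
  · rw [← A.valuation_le_one_iff, map_inv₀]
    have : 0 < A.valuation x := by simpa [zero_lt_iff] using h
    simp [h, one_lt_inv₀ this]

theorem comap_lt_one {F L : Type*} [Field F] [Field L] [Algebra F L] (A : ValuationSubring L)
    (x : F) : (A.comap (algebraMap F L)).valuation x < 1 ↔ A.valuation (algebraMap F L x) < 1 := by
  rw [lt_one_iff, lt_one_iff]
  simp [ValuationSubring.mem_comap]

variable {K L : Type*} [Field K] [Field L] [Algebra K L]

/-- closure of a subfield contained in a valuation ring under algebraic elements -/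
theorem mem_of_algebraic (A : ValuationSubring L) (h : ∀ c : K, algebraMap K L c ∈ A)
    {a : L} (ha : IsAlgebraic K a) : a ∈ A := by
  have hi : IsIntegral K a := ha.isIntegral
  obtain ⟨p, hp, hpa⟩ := hi
  let f : K →+* A := (algebraMap K L).codRestrict A.toSubring h
  have : IsIntegral A a := by
    refine ⟨p.map f, hp.map f, ?_⟩
    rw [eval₂_map]
    exact hpa
  exact A.valuation_le_one_iff a |>.1 <|
    ((Valuation.Integers.mem_of_integral (v := A.valuation) (O := A)
      ⟨Subtype.val_injective, A.valuation_le_one, fun {r} hr => ⟨⟨r, (A.valuation_le_one_iff r).1 hr⟩, rfl⟩⟩ this))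

theorem eq_zero_of_algebraic (A : ValuationSubring L) (h : ∀ c : K, algebraMap K L c ∈ A)
    {a : L} (ha : IsAlgebraic K a) (hl : A.valuation a < 1) : a = 0 := by
  rcases (lt_one_iff A a).1 hl with h0 | h0
  · exact h0
  · exact absurd (mem_of_algebraic A h ha.inv) h0

theorem exists_aeval_lt (A : ValuationSubring L) (h : ∀ c : K, algebraMap K L c ∈ A)
    (hA : A ≠ ⊤)
    (htr : ∀ y : L, Transcendental K y → Algebra.IsAlgebraic (IntermediateField.adjoin K {y}) L)
    {y : L} (hy : y ∈ A) : ∃ p : K[X], p ≠ 0 ∧ A.valuation (aeval y p) < 1 := by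
  by_contra! hc
  have hmem : ∀ p : K[X], aeval y p ∈ A := fun p => by
    rw [aeval_eq_sum_range]
    refine sum_mem fun i _ => ?_
    rw [Algebra.smul_def]
    exact mul_mem (h _) (pow_mem hy i)
  have ht : Transcendental K y := by
    rintro ⟨p, hp, hp0⟩
    have := hc p hp
    simp [hp0] at this
  have := htr y ht
  apply hA
  rw [eq_top_iff]
  intro z _
  refine mem_of_algebraic (K := IntermediateField.adjoin K {y}) A ?_ (Algebra.IsAlgebraic.isAlgebraic z)
  rintro ⟨c, hcm⟩
  change c ∈ A
  rw [IntermediateField.mem_adjoin_simple_iff] at hcm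
  obtain ⟨r, t, rfl⟩ := hcm
  by_cases ht0 : t = 0
  · simp [ht0]
  · rw [div_eq_mul_inv]
    refine mul_mem (hmem r) ?_
    have := hc t ht0
    by_contra hn
    exact absurd ((lt_one_iff A _).2 (Or.inr hn)) this.not_gt

theorem exists_irreducible_aeval_lt (A : ValuationSubring L) (h : ∀ c : K, algebraMap K L c ∈ A)
    {y : L} (p : K[X]) (hp : p ≠ 0) (hlt : A.valuation (aeval y p) < 1) (hy : y ∈ A) :
    ∃ p : K[X], Irreducible p ∧ A.valuation (aeval y p) < 1 := by
  have hmem : ∀ p : K[X], aeval y p ∈ A := fun p => by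
    rw [aeval_eq_sum_range]
    refine sum_mem fun i _ => ?_
    rw [Algebra.smul_def]
    exact mul_mem (h _) (pow_mem hy i)
  induction p using WfDvdMonoid.induction_on_irreducible with
  | zero => exact absurd rfl hp
  | unit u hu =>
    obtain ⟨c, hc, rfl⟩ := Polynomial.isUnit_iff.1 hu
    rw [aeval_C] at hlt
    have := eq_zero_of_algebraic A h (isAlgebraic_algebraMap c) hlt
    simp at this
    exact absurd this hc.ne_zero
  | mul a i ha hi ih =>
    rw [map_mul, map_mul] at hlt
    by_cases h1 : A.valuation (aeval y i) < 1
    · exact ⟨i, hi, h1⟩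
    · apply ih ha
      have h2 : A.valuation (aeval y i) = 1 :=
        le_antisymm ((A.valuation_le_one_iff _).2 (hmem i)) (not_lt.1 h1)
      rwa [h2, one_mul] at hlt

theorem exists_sep (A : ValuationSubring L) [IsAlgClosed L] (q : ℕ) [ExpChar K q]
    (h : ∀ c : K, algebraMap K L c ∈ A) (hA : A ≠ ⊤)
    (htr : ∀ y : L, Transcendental K y → Algebra.IsAlgebraic (IntermediateField.adjoin K {y}) L)
    {y : L} (hy : y ∈ A) :
    ∃ (n : ℕ) (a : separableClosure K L), A.valuation (y ^ q ^ n - a) < 1 := by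
  obtain ⟨p, hp, hlt⟩ := exists_aeval_lt A h hA htr hy
  obtain ⟨p, hp, hlt⟩ := exists_irreducible_aeval_lt A h p hp hlt hy
  obtain ⟨g, hg, n, rfl⟩ := hp.hasSeparableContraction q
  rw [expand_aeval] at hlt
  have hg0 : g ≠ 0 := hg.ne_zero
  have hspl := IsAlgClosed.splits (g.map (algebraMap K L))
  have hev : aeval (y ^ q ^ n) g = algebraMap K L g.leadingCoeff *
      ((g.map (algebraMap K L)).roots.map (fun a => y ^ q ^ n - a)).prod := by
    rw [aeval_def, ← eval_map, hspl.eval_eq_prod_roots]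
    simp
  have hlc : A.valuation (algebraMap K L g.leadingCoeff) = 1 := by
    apply le_antisymm ((A.valuation_le_one_iff _).2 (h _))
    by_contra hc
    have := eq_zero_of_algebraic A h (isAlgebraic_algebraMap _) (not_le.1 hc)
    simp at this
    exact hg0 this
  rw [hev, map_mul, hlc, one_mul, map_multiset_prod, Multiset.map_map] at hlt
  by_contra! hc
  refine absurd hlt (not_lt.2 (Multiset.one_le_prod ?_))
  intro x hx
  obtain ⟨a, ha, rfl⟩ := Multiset.mem_map.1 hx
  refine hc n ⟨a, ?_⟩
  rw [mem_separableClosure_iff]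
  refine hg.of_dvd (minpoly.dvd _ _ ?_)
  rw [mem_roots (by simpa using hg0)] at ha
  simpa [IsRoot, eval_map_algebraMap] using ha

theorem mem_inertia {F : Type*} [Field F] [Algebra F L] (A : ValuationSubring L)
    (g : A.decompositionSubgroup F) :
    g ∈ A.inertiaSubgroup F ↔ ∀ y ∈ A, A.valuation ((g : L ≃ₐ[F] L) y - y) < 1 := by
  have key : ∀ y : A, g • IsLocalRing.residue A y = IsLocalRing.residue A y ↔
      A.valuation ((g : L ≃ₐ[F] L) y - y) < 1 := by
    intro y
    rw [← IsLocalRing.ResidueField.residue_smul, ← sub_eq_zero, ← map_sub,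
      IsLocalRing.residue_eq_zero_iff, ValuationSubring.valuation_lt_one_iff]
    rfl
  rw [ValuationSubring.inertiaSubgroup, MonoidHom.mem_ker]
  constructor
  · intro hg y hy
    exact (key ⟨y, hy⟩).1 (DFunLike.congr_fun hg _)
  · intro hg
    ext z
    obtain ⟨y, rfl⟩ := IsLocalRing.residue_surjective z
    exact (key y).2 (hg _ y.2)

open scoped Pointwise in
theorem decomp_lt {F : Type*} [Field F] [Algebra F L] (A : ValuationSubring L)
    {g : L ≃ₐ[F] L} (hg : g ∈ A.decompositionSubgroup F) {y : L} (hy : A.valuation y < 1) :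
    A.valuation (g y) < 1 := by
  rw [lt_one_iff] at hy ⊢
  rcases hy with rfl | hy
  · simp
  · right
    intro hc
    apply hy
    have h1 : g • A = A := hg
    rw [← map_inv₀] at hc
    rw [← h1] at hc
    exact (ValuationSubring.smul_mem_pointwise_smul_iff (g := g)).1 hc

theorem tr_aux {F Ω : Type*} [Field F] [Field Ω] [Algebra K F] [Algebra F Ω]
    [Algebra K Ω] [IsScalarTower K F Ω] [Algebra.IsAlgebraic F Ω]
    (hcurve : ∃ x : F, Transcendental K x ∧
      FiniteDimensional (IntermediateField.adjoin K ({x} : Set F)) F)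
    (y : Ω) (hy : Transcendental K y) :
    Algebra.IsAlgebraic (IntermediateField.adjoin K {y}) Ω := by
  obtain ⟨x, hx, hfin⟩ := hcurve
  have h1 : AlgebraicIndependent K (fun _ : Unit => x) :=
    algebraicIndependent_unique_type_iff.2 hx
  have h2 : IsTranscendenceBasis K (fun _ : Unit => x) := by
    rw [h1.isTranscendenceBasis_iff_isAlgebraic, Set.range_const]
    refine ⟨fun z => ?_⟩
    have : IsAlgebraic (IntermediateField.adjoin K {x}) z := Algebra.IsAlgebraic.isAlgebraic z
    exact IntermediateField.isAlgebraic_adjoin_iff.1 this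
  have h3 := h2.algebraMap_comp (A := Ω)
  have h4 := h3.lift_cardinalMk_eq_trdeg
  have h5 : AlgebraicIndependent K (fun _ : Unit => y) :=
    algebraicIndependent_unique_type_iff.2 hy
  have h6 := (h5.isTranscendenceBasis_of_lift_trdeg_le_of_finite h4.ge).isAlgebraic_field
  rwa [Set.range_const] at h6
end SecGeo
open SecGeo

theorem section_geometric_of_contained_in_decomposition
    (K F Ω : Type*) [Field K] [Field F] [Field Ω] [Algebra K F] [Algebra F Ω]
    [Algebra K Ω] [IsScalarTower K F Ω] [IsAlgClosed Ω] [Algebra.IsAlgebraic F Ω]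
    -- `F` is the function field of a curve over `K`
    (hcurve : ∃ x : F, Transcendental K x ∧
      FiniteDimensional (IntermediateField.adjoin K ({x} : Set F)) F)
    -- a section `s` of the canonical projection `pr : G_F → G_K`
    (s : ((separableClosure K Ω) ≃ₐ[K] (separableClosure K Ω)) →* (Ω ≃ₐ[F] Ω))
    (hs : ∀ τ, AlgEquiv.restrictNormal ((s τ).restrictScalars K) (separableClosure K Ω) = τ)
    -- `W` prolongs the valuation `v_P` of `F` at a point `P ∈ X(K̄)`:
    (W : ValuationSubring Ω)
    (hPK : (W.comap (algebraMap F Ω)).comap (algebraMap K F) = ⊤)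
    (hPnt : W.comap (algebraMap F Ω) ≠ ⊤)
    -- `s(G_K)` is contained in the decomposition subgroup at `W`
    (hsub : ∀ τ, s τ ∈ W.decompositionSubgroup F) :
    -- `P ∈ X(K^perf)`: the residue field of `v_P` is purely inseparable over `K`
    (∀ x : F, x ∈ W.comap (algebraMap F Ω) → ∃ (n : ℕ) (c : K),
      (W.comap (algebraMap F Ω)).valuation
        (x ^ (ringExpChar K) ^ n - algebraMap K F c) < 1) ∧
    -- `s(G_K)` is a complement of the inertia subgroup in the decomposition subgroup
    (s.range ⊓ (W.inertiaSubgroup F).map (W.decompositionSubgroup F).subtype = ⊥ ∧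
      s.range ⊔ (W.inertiaSubgroup F).map (W.decompositionSubgroup F).subtype =
        W.decompositionSubgroup F) := by
  have hK : ∀ c : K, algebraMap K Ω c ∈ W := by
    intro c
    have : c ∈ (W.comap (algebraMap F Ω)).comap (algebraMap K F) := by rw [hPK]; trivial
    rw [IsScalarTower.algebraMap_apply K F Ω]
    exact this
  have hW : W ≠ ⊤ := by
    rintro rfl
    exact hPnt rfl
  have htr := tr_aux (Ω := Ω) hcurve
  have hlift : ∀ y ∈ W, _ := fun y hy => exists_sep W (ringExpChar K) hK hW htr hy
  have hres : ∀ (g : Ω ≃ₐ[F] Ω) (a : separableClosure K Ω),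
      ((AlgEquiv.restrictNormal (g.restrictScalars K) (separableClosure K Ω) a :
        separableClosure K Ω) : Ω) = g a := fun g a =>
    AlgEquiv.restrictNormal_commutes (g.restrictScalars K) (separableClosure K Ω) a
  have hsa : ∀ τ (a : separableClosure K Ω), s τ (a : Ω) = (τ a : separableClosure K Ω) := by
    intro τ a
    rw [← hres, hs]
  -- congruent separable elements are equal
  have hinj : ∀ a b : separableClosure K Ω, W.valuation ((a : Ω) - b) < 1 → a = b := by
    intro a b hab
    have halg : IsAlgebraic K ((a - b : separableClosure K Ω) : Ω) :=
      (mem_separableClosure_iff.1 (a - b).2).isIntegral.isAlgebraic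
    have := eq_zero_of_algebraic W hK halg (by simpa using hab)
    exact sub_eq_zero.1 (Subtype.ext this)
  have : ExpChar Ω (ringExpChar K) := expChar_of_injective_algebraMap (algebraMap K Ω).injective _
  refine ⟨?_, ?_, ?_⟩
  · intro x hx
    obtain ⟨n, a, ha⟩ := hlift _ hx
    have hfix : ∀ τ : (separableClosure K Ω) ≃ₐ[K] (separableClosure K Ω), τ a = a := by
      intro τ
      apply hinj
      have h1 := decomp_lt W (hsub τ) ha
      rw [map_sub, map_pow, AlgEquiv.commutes, hsa] at h1
      have h2 := W.valuation.map_sub_lt ha h1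
      simpa using h2
    obtain ⟨c, hc⟩ := (InfiniteGalois.mem_range_algebraMap_iff_fixed a).2 hfix
    refine ⟨n, c, ?_⟩
    rw [comap_lt_one, map_sub, map_pow, ← IsScalarTower.algebraMap_apply K F Ω]
    rw [← hc] at ha
    exact ha
  · rw [eq_bot_iff]
    rintro _ ⟨⟨τ, rfl⟩, ⟨g, hg, hgτ⟩⟩
    have hg' := (mem_inertia W g).1 hg
    have hgτ' : (g : Ω ≃ₐ[F] Ω) = s τ := hgτ
    have : τ = 1 := by
      ext a : 1
      apply hinj
      have ha : (a : Ω) ∈ W := mem_of_algebraic W hK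
        (mem_separableClosure_iff.1 a.2).isIntegral.isAlgebraic
      have := hg' a ha
      rw [hgτ', hsa] at this
      exact this
    rw [this, map_one]
    exact Subgroup.mem_bot.2 rfl
  · apply le_antisymm
    · apply sup_le
      · rintro _ ⟨τ, rfl⟩
        exact hsub τ
      · exact Subgroup.map_subtype_le _
    · intro σ hσ
      set τ := AlgEquiv.restrictNormal (σ.restrictScalars K) (separableClosure K Ω) with hτ
      have hd : (s τ)⁻¹ * σ ∈ W.decompositionSubgroup F :=
        mul_mem (inv_mem (hsub τ)) hσ
      have hfix : ∀ a : separableClosure K Ω, ((s τ)⁻¹ * σ) (a : Ω) = a := by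
        intro a
        rw [AlgEquiv.mul_apply, ← hres, ← hτ, ← hsa]
        exact AlgEquiv.symm_apply_apply _ _
      have hin : (⟨(s τ)⁻¹ * σ, hd⟩ : W.decompositionSubgroup F) ∈ W.inertiaSubgroup F := by
        rw [mem_inertia]
        intro y hy
        obtain ⟨n, a, ha⟩ := hlift y hy
        have h1 := decomp_lt W hd ha
        rw [map_sub, map_pow, hfix] at h1
        have h2 := W.valuation.map_sub_lt h1 ha
        rw [sub_sub_sub_cancel_right, ← sub_pow_expChar_pow, map_pow] at h2
        by_contra hc
        exact absurd h2 (not_lt.2 (one_le_pow₀ (not_lt.1 hc)))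
      rw [show σ = s τ * ((s τ)⁻¹ * σ) by group]
      exact mul_mem (Subgroup.mem_sup_left ⟨τ, rfl⟩)
        (Subgroup.mem_sup_right ⟨_, hin, rfl⟩)
end

section
/- Let p be a prime and let K be a field of characteristic 0 admitting a henselian valuation v with divisible value group whose residue field k is a relatively algebraically closed subfield of a finite extension of ℚ_p. Then the restriction map res : G_K → G_k on absolute Galois groups is an isomorphism. -/
open Polynomial Pointwise IsLocalRing

theorem hens_finite_smul {A B G : Type*} [CommRing A] [CommRing B] [IsDomain B] [Algebra A B]
    [HenselianLocalRing A] [Group G] [Finite G] [MulSemiringAction G B] [SMulCommClass G A B]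
    [Algebra.IsInvariant A B G] (P : Ideal B) [hP : P.IsMaximal]
    (hPA : P.under A = maximalIdeal A) (h : G) : h • P = P := by
  classical
  cases nonempty_fintype G
  by_contra hne
  have memA (a : A) : algebraMap A B a ∈ P ↔ a ∈ maximalIdeal A := by
    rw [← hPA]; rfl
  let s : Finset G := Finset.univ.filter (fun g => g • P ≠ P)
  have hcop : P ⊔ ∏ g ∈ s, g • P = ⊤ := by
    apply Ideal.sup_prod_eq_top
    intro g hg
    have hg' : g • P ≠ P := by simpa [s] using hg
    have : (g • P).IsMaximal := by
      rw [Ideal.pointwise_smul_eq_comap]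
      exact Ideal.comap_isMaximal_of_surjective _ (RingEquiv.surjective _)
    exact Ideal.IsMaximal.coprime_of_ne hP this (Ne.symm hg')
  obtain ⟨q, hq, x, hx, hqx⟩ := Submodule.mem_sup.1 ((Ideal.eq_top_iff_one _).1 hcop)
  have hxs (g : G) (hg : g • P ≠ P) : x ∈ g • P :=
    Ideal.le_of_dvd (Finset.dvd_prod_of_mem (fun g => g • P) (by simpa [s] using hg)) hx
  have hx1 : 1 - x ∈ P := by rw [← hqx]; simpa using hq
  let D := MulAction.stabilizer G P
  let y : B := ∏ d : D, d • x
  have hyD (d : D) : d • y = y := Finset.smul_prod_perm ..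
  have hdP (d : D) : (d : G) • P = P := d.2
  have hy1 : 1 - y ∈ P := by
    rw [← Ideal.Quotient.eq, map_one, map_prod]
    symm
    apply Finset.prod_eq_one
    intro d _
    rw [← map_one (Ideal.Quotient.mk P), eq_comm, Ideal.Quotient.eq]
    have := Ideal.smul_mem_pointwise_smul (d : G) _ _ hx1
    rw [hdP, smul_sub, smul_one] at this
    exact this
  have hyP (g : G) (hg : g • P ≠ P) : g • y ∈ P := by
    have h1 : g⁻¹ • P ≠ P := fun h => hg (by rw [← h, smul_inv_smul, h])
    have : x ∈ g⁻¹ • P := hxs _ h1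
    have h2 : y = x * ∏ d ∈ (Finset.univ : Finset D).erase 1, d • x := by
      show ∏ d : D, d • x = _
      rw [← Finset.mul_prod_erase _ _ (Finset.mem_univ (1 : D)), one_smul]
    have h3 : y ∈ g⁻¹ • P := by rw [h2]; exact Ideal.mul_mem_right _ _ this
    rwa [Ideal.mem_inv_pointwise_smul_iff] at h3
  have hyP' : y ∉ P := fun hy => hP.ne_top ((Ideal.eq_top_iff_one _).2 (by
    simpa using P.add_mem hy1 hy))
  let O : Finset B := Finset.univ.image (fun g : G => g • y)
  have hOy : y ∈ O := Finset.mem_image.2 ⟨1, Finset.mem_univ _, one_smul _ _⟩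
  have hO (z : B) (hz : z ∈ O) (hzy : z ≠ y) : z ∈ P := by
    obtain ⟨g, -, rfl⟩ := Finset.mem_image.1 hz
    apply hyP
    intro hg
    exact hzy (hyD ⟨g, hg⟩)
  let F : B[X] := ∏ z ∈ O, (X - C z)
  have hF : F.Monic := monic_prod_of_monic _ _ fun _ _ => monic_X_sub_C _
  have hinv (g : G) : g • F = F := by
    simp only [F, Finset.smul_prod', smul_sub, smul_X, smul_C]
    apply Finset.prod_bij (fun z _ => g • z)
    · intro z hz
      obtain ⟨k, -, rfl⟩ := Finset.mem_image.1 hz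
      exact Finset.mem_image.2 ⟨g * k, Finset.mem_univ _, mul_smul _ _ _⟩
    · intro a _ b _ hab
      exact smul_left_cancel g hab
    · intro z hz
      obtain ⟨k, -, rfl⟩ := Finset.mem_image.1 hz
      exact ⟨(g⁻¹ * k) • y, Finset.mem_image.2 ⟨g⁻¹ * k, Finset.mem_univ _, rfl⟩, by
        rw [← mul_smul, mul_inv_cancel_left]⟩
    · intro _ _; rfl
  have hlift : F ∈ Polynomial.lifts (algebraMap A B) :=
    F.lifts_iff_coeff_lifts.mpr fun n ↦ Algebra.IsInvariant.isInvariant (G := G) _ fun g => by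
      rw [← coeff_smul, hinv]
  obtain ⟨f, hfF, -, hfm⟩ := lifts_and_natDegree_eq_and_monic hlift hF
  have hev (g : A[X]) (a : A) : algebraMap A B (g.eval a) =
      (g.map (algebraMap A B)).eval (algebraMap A B a) := by
    rw [eval_map_algebraMap, aeval_algebraMap_apply, coe_aeval_eq_eval]
  have hFy : F = (X - C y) * ∏ z ∈ O.erase y, (X - C z) := (Finset.mul_prod_erase _ _ hOy).symm
  obtain ⟨a, ha, ha1⟩ := HenselianLocalRing.is_henselian f hfm 1
    (by
      rw [← memA, hev, hfF, hFy, map_one, eval_mul]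
      exact Ideal.mul_mem_right _ _ (by simpa using hy1))
    (by
      by_contra hcon
      have : f.derivative.eval 1 ∈ maximalIdeal A := hcon
      rw [← memA, hev, ← derivative_map, hfF, hFy, map_one, derivative_mul, eval_add, eval_mul,
        eval_mul] at this
      rw [Ideal.add_mem_iff_left _ (Ideal.mul_mem_right _ _ (by simpa using hy1))] at this
      simp only [derivative_sub, derivative_X, derivative_C, sub_zero, eval_one, one_mul,
        eval_prod] at this
      rw [hP.isPrime.prod_mem_iff] at this
      obtain ⟨z, hz, hzP⟩ := this
      have hz' := hO z (Finset.mem_of_mem_erase hz) (Finset.ne_of_mem_erase hz)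
      exact hP.ne_top ((Ideal.eq_top_iff_one _).2 (by simpa using P.add_mem hzP hz')))
  have h0 : F.eval (algebraMap A B a) = 0 := by
    rw [← hfF, ← hev, ha.eq_zero, map_zero]
  rw [eval_prod, Finset.prod_eq_zero_iff] at h0
  obtain ⟨z, hz, hz0⟩ := h0
  obtain ⟨g, -, rfl⟩ := Finset.mem_image.1 hz
  have haz : algebraMap A B a = g • y := by simpa [sub_eq_zero] using hz0
  have hay : y = algebraMap A B a := by
    rw [eq_comm, ← smul_algebraMap g⁻¹ a, haz, inv_smul_smul]
  have hcon : h • y ∈ P := hyP h hne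
  rw [hay, smul_algebraMap, ← hay] at hcon
  exact hyP' hcon

theorem hens_finite_unique {A B G : Type*} [CommRing A] [CommRing B] [IsDomain B] [Algebra A B]
    [HenselianLocalRing A] [Group G] [Finite G] [MulSemiringAction G B] [SMulCommClass G A B]
    [Algebra.IsInvariant A B G] (P Q : Ideal B) [hP : P.IsMaximal] [Q.IsMaximal]
    (hPA : P.under A = maximalIdeal A) (hQA : Q.under A = maximalIdeal A) : P = Q := by
  obtain ⟨g, hg⟩ := Algebra.IsInvariant.exists_smul_of_under_eq A B G P Q (hPA.trans hQA.symm)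
  rw [hg, hens_finite_smul P hPA g]

theorem hens_profinite_unique {A B : Type*} {G : Type*} [CommRing A] [CommRing B] [IsDomain B]
    [Algebra A B] [HenselianLocalRing A] [Group G] [MulSemiringAction G B] [SMulCommClass G A B]
    [TopologicalSpace G] [CompactSpace G] [TotallyDisconnectedSpace G]
    [IsTopologicalGroup G] [TopologicalSpace B] [DiscreteTopology B] [ContinuousSMul G B]
    [Algebra.IsInvariant A B G] : IsLocalRing B := by
  have hint : Algebra.IsIntegral A B := Algebra.IsInvariant.isIntegral_of_profinite (G := G)
  obtain ⟨P, hP⟩ := Ideal.exists_maximal B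
  refine IsLocalRing.of_unique_max_ideal ⟨P, hP, fun Q hQ => ?_⟩
  refine hQ.eq_of_le hP.ne_top fun x hx => ?_
  obtain ⟨N, hN⟩ := ProfiniteGrp.exist_openNormalSubgroup_sub_open_nhds_of_one
    (stabilizer_isOpen G x) (one_mem _)
  let B' := FixedPoints.subalgebra A B N.1.1
  have h1 : Algebra.IsIntegral B' B := Algebra.IsIntegral.tower_top A
  have hB' : Algebra.IsIntegral A B' := Algebra.IsInvariant.isIntegral A B' (G ⧸ N.1.1)
  have hm (I : Ideal B) (hI : I.IsMaximal) : (I.under B').IsMaximal :=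
    Ideal.isMaximal_comap_of_isIntegral_of_isMaximal I
  have hm' (I : Ideal B') (hI : I.IsMaximal) : I.under A = maximalIdeal A :=
    IsLocalRing.eq_maximalIdeal (Ideal.isMaximal_comap_of_isIntegral_of_isMaximal I)
  have := hm P hP
  have := hm Q hQ
  have key := hens_finite_unique (A := A) (G := G ⧸ N.1.1) (P.under B') (Q.under B')
    (hm' _ (hm P hP)) (hm' _ (hm Q hQ))
  have hx' : (⟨x, fun g ↦ hN g.2⟩ : B') ∈ Q.under B' := hx
  rw [← key] at hx'
  exact hx'

set_option linter.unusedSectionVars false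

section hensMain
variable {K : Type*} [Field K] [CharZero K] (v : ValuationSubring K)
  {L : Type*} [Field L] [Algebra K L] [IsAlgClosed L] [Algebra.IsAlgebraic K L]

theorem hens_isInvariant :
    Algebra.IsInvariant v (integralClosure v L) (L ≃ₐ[K] L) := by
  have : IsAlgClosure K L := ⟨inferInstance, inferInstance⟩
  have : Normal K L := IsAlgClosure.normal K L
  have : IsGalois K L := ⟨⟩
  refine ⟨fun b hb => ?_⟩
  obtain ⟨c, hc⟩ := Algebra.IsInvariant.isInvariant (A := K) (G := L ≃ₐ[K] L) (b : L)
    (fun g => congrArg Subtype.val (hb g))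
  have hi : IsIntegral v c := by
    rw [← isIntegral_algebraMap_iff (FaithfulSMul.algebraMap_injective K L), hc]
    exact b.2
  obtain ⟨a, rfl⟩ := IsIntegrallyClosed.algebraMap_eq_of_integral hi
  exact ⟨a, Subtype.ext hc⟩

theorem hens_isLocalRing [HenselianLocalRing v] : IsLocalRing (integralClosure v L) := by
  have : IsAlgClosure K L := ⟨inferInstance, inferInstance⟩
  have : Normal K L := IsAlgClosure.normal K L
  have : IsGalois K L := ⟨⟩
  have := hens_isInvariant v (L := L)
  let : TopologicalSpace (integralClosure v L) := ⊥
  have : DiscreteTopology (integralClosure v L) := ⟨rfl⟩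
  have : ContinuousSMul (L ≃ₐ[K] L) (integralClosure v L) := by
    rw [continuousSMul_iff_stabilizer_isOpen]
    intro x
    convert stabilizer_isOpen_of_isIntegral (K := K) (x : L) using 2
    ext g
    simp [MulAction.mem_stabilizer_iff, Subtype.ext_iff]
  exact hens_profinite_unique (A := v) (G := L ≃ₐ[K] L)

theorem hens_smul_mem [IsLocalRing (integralClosure v L)] (g : L ≃ₐ[K] L)
    (x : integralClosure v L) (hx : x ∈ maximalIdeal (integralClosure v L)) :
    g • x ∈ maximalIdeal (integralClosure v L) := by
  rw [IsLocalRing.mem_maximalIdeal, mem_nonunits_iff] at hx ⊢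
  intro h
  apply hx
  have := h.map (MulSemiringAction.toRingHom (L ≃ₐ[K] L) (integralClosure v L) g⁻¹)
  simpa using this

theorem hens_factor [IsLocalRing (integralClosure v L)]
    (hdiv : ∀ (x : Kˣ) (n : ℕ), 0 < n → ∃ y : Kˣ, v.valuation (y : K) ^ n = v.valuation (x : K))
    (x : L) (hx : x ≠ 0) : ∃ c : K, c ≠ 0 ∧ ∃ u : integralClosure v L, IsUnit u ∧
      x = algebraMap K L c * u := by
  classical
  have : IsAlgClosure K L := ⟨inferInstance, inferInstance⟩
  have : Normal K L := IsAlgClosure.normal K L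
  have : IsGalois K L := ⟨⟩
  set f := minpoly K x with hf
  have hxi : IsIntegral K x := Algebra.IsIntegral.isIntegral x
  have hmon : f.Monic := minpoly.monic hxi
  set n := f.natDegree with hn
  have h0 : f.coeff 0 ≠ 0 := minpoly.coeff_zero_ne_zero hxi hx
  have hnpos : 0 < n := minpoly.natDegree_pos hxi
  have hch (i : ℕ) : ∃ c : K, c ≠ 0 ∧ (i < n → f.coeff i ≠ 0 →
      v.valuation c ^ (n - i) = v.valuation (f.coeff i)) := by
    by_cases h : i < n ∧ f.coeff i ≠ 0
    · obtain ⟨y, hy⟩ := hdiv (Units.mk0 _ h.2) (n - i) (by omega)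
      exact ⟨y, y.ne_zero, fun _ _ => hy⟩
    · exact ⟨1, one_ne_zero, fun h1 h2 => absurd ⟨h1, h2⟩ h⟩
  choose cf hcf0 hcf using hch
  let s : Finset ℕ := (Finset.range n).filter (fun i => f.coeff i ≠ 0)
  obtain ⟨j, hj, hmax⟩ := s.exists_max_image (fun i => v.valuation (cf i))
    ⟨0, by simp [s, h0, hnpos]⟩
  have hj' : j < n ∧ f.coeff j ≠ 0 := by simpa [s] using hj
  set c := cf j with hc
  have hc0 : c ≠ 0 := hcf0 j
  have hvc : v.valuation c ≠ 0 := (Valuation.ne_zero_iff _).2 hc0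
  set g := f.scaleRoots c⁻¹ with hg
  have hgm : g.Monic := (monic_scaleRoots_iff _).2 hmon
  have hgn : g.natDegree = n := natDegree_scaleRoots _ _
  have hgv (i : ℕ) : v.valuation (g.coeff i) ≤ 1 := by
    rcases lt_trichotomy i n with hi | hi | hi
    · by_cases hz : f.coeff i = 0
      · simp [hg, coeff_scaleRoots, hz]
      · rw [hg, coeff_scaleRoots, map_mul, map_pow, map_inv₀, ← hn, ← hcf i hi hz, ← mul_pow]
        apply pow_le_one'
        rw [← div_eq_mul_inv]
        exact div_le_one_of_le₀ (hmax i (by simp [s, hi, hz])) zero_le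
    · rw [hi, ← hgn, hgm.coeff_natDegree, map_one]
    · rw [coeff_eq_zero_of_natDegree_lt (by omega), map_zero]; exact zero_le
  have hgj : v.valuation (g.coeff j) = 1 := by
    rw [hg, coeff_scaleRoots, map_mul, map_pow, map_inv₀, ← hn, ← hcf j hj'.1 hj'.2, ← mul_pow,
      mul_inv_cancel₀ hvc, one_pow]
  have hglift : g ∈ Polynomial.lifts (algebraMap v K) :=
    g.lifts_iff_coeff_lifts.mpr fun i => ⟨⟨g.coeff i, (v.valuation_le_one_iff _).1 (hgv i)⟩, rfl⟩
  obtain ⟨G, hGg, -, hGm⟩ := lifts_and_natDegree_eq_and_monic hglift hgm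
  have hroot (z : L) (hz : aeval z g = 0) : IsIntegral v z := by
    refine ⟨G, hGm, ?_⟩
    rw [← aeval_def, ← aeval_map_algebraMap K, hGg, hz]
  have hcL : algebraMap K L c ≠ 0 := by simpa using hc0
  have hzroot : aeval (algebraMap K L c⁻¹ * x) g = 0 :=
    scaleRoots_aeval_eq_zero (minpoly.aeval K x)
  let z : integralClosure v L := ⟨algebraMap K L c⁻¹ * x, hroot _ hzroot⟩
  refine ⟨c, hc0, z, ?_, ?_⟩
  swap
  · simp only [z, map_inv₀]; field_simp
  by_contra hzu
  have hzM : z ∈ maximalIdeal (integralClosure v L) := hzu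
  have hconj (w : L) (hw : aeval w g = 0) : ∃ w' : integralClosure v L, (w' : L) = w ∧
      w' ∈ maximalIdeal (integralClosure v L) := by
    have : aeval (algebraMap K L c * w) f = 0 := by
      have h2 := scaleRoots_aeval_eq_zero (r := c) hw
      have h3 : g.scaleRoots c = f := by
        rw [hg, ← scaleRoots_mul, inv_mul_cancel₀ hc0, scaleRoots_one]
      rwa [h3] at h2
    obtain ⟨σ, hσ⟩ := minpoly.exists_algEquiv_of_root' (K := K) hxi.isAlgebraic this
    refine ⟨σ • z, ?_, hens_smul_mem v σ z hzM⟩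
    rw [integralClosure.coe_smul]
    simp only [z, AlgEquiv.smul_def, map_mul, AlgEquiv.commutes, hσ, map_inv₀]
    field_simp
  have hsplit : g.map (algebraMap K L) =
      (((g.map (algebraMap K L)).roots).map (fun a => X - C a)).prod :=
    (IsAlgClosed.splits _).eq_prod_roots_of_monic (hgm.map _)
  have hall : ∀ w ∈ (g.map (algebraMap K L)).roots, ∃ w' : integralClosure v L, (w' : L) = w ∧
      w' ∈ maximalIdeal (integralClosure v L) := by
    intro w hw
    apply hconj
    rw [mem_roots (hgm.map _).ne_zero, IsRoot, eval_map_algebraMap] at hw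
    exact hw
  choose! lf hlf1 hlf2 using hall
  set R := (g.map (algebraMap K L)).roots with hR
  let PB : (integralClosure v L)[X] := (R.map (fun a => X - C (lf a))).prod
  have hPB1 : PB.map (algebraMap (integralClosure v L) L) = g.map (algebraMap K L) := by
    rw [hsplit, Polynomial.map_multiset_prod, Multiset.map_map]
    congr 1
    apply Multiset.map_congr rfl
    intro w hw
    simp only [Function.comp, Polynomial.map_sub, map_X, map_C]
    congr 2
    exact hlf1 w hw
  have hPB2 : PB.map (residue (integralClosure v L)) = X ^ (Multiset.card R) := by
    rw [Polynomial.map_multiset_prod, Multiset.map_map, ← Multiset.prod_replicate,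
      ← Multiset.map_const' ]
    congr 1
    apply Multiset.map_congr rfl
    intro w hw
    simp only [Function.comp, Polynomial.map_sub, map_X, map_C]
    rw [(residue_eq_zero_iff _).2 (hlf2 w hw)]
    simp
  have hcard : Multiset.card R = n := by
    rw [hR, ← (IsAlgClosed.splits _).natDegree_eq_card_roots, natDegree_map, hgn]
  have hcM : residue (integralClosure v L) (PB.coeff j) = 0 := by
    rw [← coeff_map, hPB2, hcard, coeff_X_pow, if_neg (by omega)]
  have hcE : PB.coeff j = algebraMap v (integralClosure v L) (G.coeff j) := by
    apply Subtype.ext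
    have h1 : (PB.map (algebraMap (integralClosure v L) L)).coeff j =
      ((G.map (algebraMap v K)).map (algebraMap K L)).coeff j := by rw [hPB1, hGg]
    simp only [coeff_map] at h1
    exact h1
  have hGu : IsUnit (G.coeff j) := by
    rw [ValuationSubring.valuation_eq_one_iff]
    have : ((G.coeff j : v) : K) = g.coeff j := by rw [← hGg, coeff_map]; rfl
    rw [this, hgj]
  rw [hcE] at hcM
  exact ((hGu.map (algebraMap v (integralClosure v L))).map
    (residue (integralClosure v L))).ne_zero hcM

theorem hens_inertia [HenselianLocalRing v] [IsLocalRing (integralClosure v L)]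
    [CharZero (ResidueField v)]
    (hdiv : ∀ (x : Kˣ) (n : ℕ), 0 < n → ∃ y : Kˣ, v.valuation (y : K) ^ n = v.valuation (x : K))
    (σ : L ≃ₐ[K] L) (hσ : ∀ b : integralClosure v L, residue _ (σ • b) = residue _ b) : σ = 1 := by
  have : CharZero L := charZero_of_injective_algebraMap (algebraMap K L).injective
  ext x
  rw [AlgEquiv.one_apply]
  obtain ⟨n, hn, hnx⟩ : ∃ n : ℕ, 0 < n ∧ (σ ^ n) x = x := by
    have hfin : (Set.range (fun i : ℕ => (σ ^ i) x)).Finite := by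
      apply ((minpoly K x).rootSet_finite L).subset
      rintro _ ⟨i, rfl⟩
      rw [mem_rootSet]
      refine ⟨minpoly.ne_zero (Algebra.IsIntegral.isIntegral x), ?_⟩
      show aeval ((σ ^ i) x) _ = 0
      rw [aeval_algHom_apply (σ ^ i), minpoly.aeval, map_zero]
    have hni : ¬ Function.Injective (fun i : ℕ => (σ ^ i) x) := fun h =>
      Set.infinite_range_of_injective h hfin
    simp only [Function.Injective] at hni
    push Not at hni
    obtain ⟨a, b, hab, hne⟩ := hni
    wlog hlt : a < b generalizing a b
    · exact this b a hab.symm hne.symm (by omega)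
    refine ⟨b - a, by omega, ?_⟩
    apply (σ ^ a).injective
    rw [← AlgEquiv.mul_apply, ← pow_add, show a + (b - a) = b by omega, ← hab]
  set S : L := ∑ i ∈ Finset.range n, (σ ^ i) x with hS
  have hσS : σ S = S := by
    have h1 : σ S = ∑ i ∈ Finset.range n, (σ ^ (i + 1)) x := by
      rw [hS, map_sum]
      refine Finset.sum_congr rfl fun i _ => ?_
      rw [pow_succ', AlgEquiv.mul_apply]
    have h2 := Finset.sum_range_succ (fun i => (σ ^ i) x) n
    rw [Finset.sum_range_succ', hnx, pow_zero, AlgEquiv.one_apply] at h2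
    rw [h1]
    exact add_right_cancel h2
  have hn0 : (n : L) ≠ 0 := by exact_mod_cast hn.ne'
  have hσS' (i : ℕ) : (σ ^ i) S = S := by
    induction i with
    | zero => rfl
    | succ i ih => rw [pow_succ', AlgEquiv.mul_apply, ih, hσS]
  set x' := x - S / n with hx'
  have hsum : ∑ i ∈ Finset.range n, (σ ^ i) x' = 0 := by
    simp only [hx', map_sub, map_div₀, hσS', map_natCast, Finset.sum_sub_distrib,
      Finset.sum_const, Finset.card_range, nsmul_eq_mul]
    rw [← hS]; field_simp; ring
  by_cases h0 : x' = 0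
  · have hxS : x = S / n := sub_eq_zero.1 h0
    rw [hxS, map_div₀, map_natCast, hσS]
  exfalso
  obtain ⟨c, hc, u, hu, hcu⟩ := hens_factor v hdiv x' h0
  have hsum' : ∑ i ∈ Finset.range n, (σ ^ i) • u = 0 := by
    apply Subtype.ext
    have hcL : algebraMap K L c ≠ 0 := by simpa using hc
    apply mul_left_cancel₀ hcL
    rw [ZeroMemClass.coe_zero, mul_zero, ← hsum, hcu]
    simp only [AddSubmonoidClass.coe_finsetSum, integralClosure.coe_smul, AlgEquiv.smul_def,
      map_mul, AlgEquiv.commutes, Finset.mul_sum]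
  have hres (i : ℕ) : residue _ ((σ ^ i) • u) = residue _ u := by
    induction i with
    | zero => simp
    | succ i ih => rw [pow_succ', mul_smul, hσ, ih]
  have h3 := congrArg (residue (integralClosure v L)) hsum'
  rw [map_sum, map_zero] at h3
  simp only [hres, Finset.sum_const, Finset.card_range, nsmul_eq_mul] at h3
  have h4 : ((n : ℕ) : ResidueField v) ≠ 0 := by exact_mod_cast hn.ne'
  have h5 : IsUnit ((n : ℕ) : v) := by
    rw [← residue_ne_zero_iff_isUnit, map_natCast]; exact h4
  have h6 : IsUnit ((n : ℕ) : integralClosure v L) := by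
    simpa using h5.map (algebraMap v (integralClosure v L))
  rcases mul_eq_zero.1 h3 with h | h
  · rw [← map_natCast (residue (integralClosure v L))] at h
    exact (h6.map (residue _)).ne_zero h
  · exact (hu.map (residue _)).ne_zero h

theorem hens_residue_isAlgClosed [IsLocalRing (integralClosure v L)] :
    IsAlgClosed (ResidueField (integralClosure v L)) := by
  apply IsAlgClosed.of_exists_root
  intro p hp hirr
  obtain ⟨q, hq, hdeg, hqm⟩ := lifts_and_natDegree_eq_and_monic
    (f := residue (integralClosure v L)) (p := p)
    (p.lifts_iff_coeff_lifts.mpr fun i => residue_surjective _) hp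
  have hpd : 0 < p.natDegree := hirr.natDegree_pos
  obtain ⟨z, hz⟩ := IsAlgClosed.exists_root (q.map (algebraMap (integralClosure v L) L)) (by
    rw [hqm.degree_map, degree_eq_natDegree hqm.ne_zero, hdeg]
    exact_mod_cast hpd.ne')
  have hzi : IsIntegral (integralClosure v L) z := ⟨q, hqm, by rwa [IsRoot, eval_map] at hz⟩
  have hzi' : IsIntegral v z := isIntegral_trans z hzi
  let w : integralClosure v L := ⟨z, hzi'⟩
  have hw : q.eval w = 0 := by
    apply Subtype.ext
    have h1 := hz
    rw [IsRoot, show z = algebraMap (integralClosure v L) L w from rfl, eval_map_algebraMap,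
      aeval_algebraMap_apply, coe_aeval_eq_eval] at h1
    exact h1
  exact ⟨residue _ w, by rw [← hq, eval_map, eval₂_at_apply, hw, map_zero]⟩

end hensMain

theorem hens_final {k κ G : Type*} [Field k] [Field κ] [Algebra k κ] [Algebra.IsAlgebraic k κ]
    [IsAlgClosed κ] [Group G] [TopologicalSpace G] [IsTopologicalGroup G] [CompactSpace G]
    (φ : G →* (κ ≃ₐ[k] κ)) (hφ : Function.Bijective φ)
    (hopen : ∀ y : κ, ∃ U : Subgroup G, IsOpen (U : Set G) ∧ ∀ g ∈ U, φ g y = y) :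
    ∃ e : G ≃* (AlgebraicClosure k ≃ₐ[k] AlgebraicClosure k), Continuous e ∧ Continuous e.symm := by
  have : IsAlgClosure k κ := ⟨inferInstance, inferInstance⟩
  let ψ : κ ≃ₐ[k] AlgebraicClosure k := IsAlgClosure.equiv k κ (AlgebraicClosure k)
  let e : G ≃* (AlgebraicClosure k ≃ₐ[k] AlgebraicClosure k) :=
    (MulEquiv.ofBijective φ hφ).trans ψ.autCongr
  have he (g : G) (y : AlgebraicClosure k) : e g y = ψ (φ g (ψ.symm y)) := rfl
  have hcont : Continuous e := by
    apply continuous_of_continuousAt_one e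
    rw [ContinuousAt, map_one]
    intro s hs
    rw [krullTopology_mem_nhds_one_iff] at hs
    obtain ⟨E, hE, hEs⟩ := hs
    obtain ⟨t, rfl⟩ := IntermediateField.fg_of_fg_toSubalgebra E
      (Subalgebra.fg_of_fg_toSubmodule (Module.Finite.iff_fg.1 hE))
    choose U hU hU' using hopen
    have hmem : (⋂ y ∈ t, (U (ψ.symm y) : Set G)) ∈ nhds (1 : G) :=
      (Filter.biInter_finset_mem t).2 fun y _ => (hU _).mem_nhds (one_mem _)
    rw [Filter.mem_map]
    refine Filter.mem_of_superset hmem fun g hg => hEs ?_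
    have hg' : ∀ y ∈ t, g ∈ U (ψ.symm y) := by simpa using hg
    rw [SetLike.mem_coe, IntermediateField.mem_fixingSubgroup_iff]
    have := (IntermediateField.forall_mem_adjoin_smul_eq_self_iff k
      (S := (t : Set (AlgebraicClosure k))) (e g)).2 (by
        intro y hy
        rw [AlgEquiv.smul_def, he, hU' _ _ (hg' y hy), ψ.apply_symm_apply])
    simpa using this
  refine ⟨e, hcont, ?_⟩
  exact (Continuous.homeoOfEquivCompactToT2 (f := e.toEquiv) hcont).symm.continuous

theorem hens_main {K : Type*} [Field K] [CharZero K]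
    (L : Type*) [Field L] [Algebra K L] [IsAlgClosed L] [Algebra.IsAlgebraic K L]
    (v : ValuationSubring K) (hhens : HenselianLocalRing v)
    (hdiv : ∀ (x : Kˣ) (n : ℕ), 0 < n → ∃ y : Kˣ, v.valuation (y : K) ^ n = v.valuation (x : K))
    [CharZero (ResidueField v)] :
    ∃ e : (L ≃ₐ[K] L) ≃*
        (AlgebraicClosure (IsLocalRing.ResidueField v) ≃ₐ[IsLocalRing.ResidueField v]
          AlgebraicClosure (IsLocalRing.ResidueField v)),
      Continuous e ∧ Continuous e.symm := by
  have : IsAlgClosure K L := ⟨inferInstance, inferInstance⟩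
  have : Normal K L := IsAlgClosure.normal K L
  have : IsGalois K L := ⟨⟩
  have := hens_isInvariant v (L := L)
  have hloc : IsLocalRing (integralClosure v L) := hens_isLocalRing v
  have := hens_residue_isAlgClosed v (L := L)
  have : FaithfulSMul v (integralClosure v L) := inferInstance
  have : Algebra.IsIntegral v (integralClosure v L) := inferInstance
  have : IsLocalHom (algebraMap v (integralClosure v L)) :=
    Algebra.IsIntegral.isLocalHom v (integralClosure v L)
  let : TopologicalSpace (integralClosure v L) := ⊥
  have : DiscreteTopology (integralClosure v L) := ⟨rfl⟩
  have hst (x : integralClosure v L) : IsOpen (MulAction.stabilizer (L ≃ₐ[K] L) x : Set (L ≃ₐ[K] L)) := by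
    convert stabilizer_isOpen_of_isIntegral (K := K) (x : L) using 2
    ext g
    simp [MulAction.mem_stabilizer_iff, Subtype.ext_iff]
  have : ContinuousSMul (L ≃ₐ[K] L) (integralClosure v L) := by
    rw [continuousSMul_iff_stabilizer_isOpen]
    exact hst
  have : SMulCommClass (L ≃ₐ[K] L) (ResidueField v) (ResidueField (integralClosure v L)) := by
    constructor
    intro g a b
    obtain ⟨a, rfl⟩ := residue_surjective a
    rw [Algebra.smul_def, Algebra.smul_def, ResidueField.algebraMap_residue, smul_mul',
      ← ResidueField.residue_smul, smul_algebraMap]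
  have : Algebra.IsAlgebraic (ResidueField v) (ResidueField (integralClosure v L)) := by
    refine ⟨fun y => IsIntegral.isAlgebraic ?_⟩
    obtain ⟨b, rfl⟩ := residue_surjective y
    obtain ⟨q, hqm, hq⟩ := Algebra.IsIntegral.isIntegral (R := v) b
    refine ⟨q.map (residue v), hqm.map _, ?_⟩
    have hcomp : (algebraMap (ResidueField v) (ResidueField (integralClosure v L))).comp
        (residue v) = (residue _).comp (algebraMap v (integralClosure v L)) := by
      ext a; exact ResidueField.algebraMap_residue a
    rw [eval₂_map, hcomp, ← hom_eval₂, hq, map_zero]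
  let φ := MulSemiringAction.toAlgAut (L ≃ₐ[K] L) (ResidueField v)
    (ResidueField (integralClosure v L))
  have hφ (g : L ≃ₐ[K] L) (b : integralClosure v L) : φ g (residue _ b) = residue _ (g • b) := rfl
  refine hens_final φ ⟨?_, ?_⟩ ?_
  · rw [injective_iff_map_eq_one]
    intro σ hσ
    apply hens_inertia v hdiv
    intro b
    rw [← hφ, hσ, AlgEquiv.one_apply]
  · intro τ
    have : (maximalIdeal (integralClosure v L)).LiesOver (maximalIdeal v) := inferInstance
    let τ' : (integralClosure v L ⧸ maximalIdeal (integralClosure v L)) ≃ₐ[v ⧸ maximalIdeal v]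
      (integralClosure v L ⧸ maximalIdeal (integralClosure v L)) :=
      AlgEquiv.ofRingEquiv (f := (τ : ResidueField (integralClosure v L) ≃+*
        ResidueField (integralClosure v L))) (fun x => τ.commutes x)
    obtain ⟨g, hg⟩ := Ideal.Quotient.stabilizerHom_surjective_of_profinite (G := L ≃ₐ[K] L)
      (maximalIdeal v) (maximalIdeal (integralClosure v L)) τ'
    refine ⟨g, ?_⟩
    ext y
    obtain ⟨b, rfl⟩ := residue_surjective y
    exact DFunLike.congr_fun hg (Ideal.Quotient.mk _ b)
  · intro y
    obtain ⟨b, rfl⟩ := residue_surjective y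
    refine ⟨MulAction.stabilizer (L ≃ₐ[K] L) b, hst b, fun g hg => ?_⟩
    rw [hφ, MulAction.mem_stabilizer_iff.1 hg]

/-- Let `p` be a prime and `K` a field of characteristic `0` admitting a henselian
valuation `v` with divisible value group whose residue field `k` is (isomorphic to) a
relatively algebraically closed subfield of a finite extension of `ℚ_p`.  Then the
restriction map `res : G_K → G_k` on absolute Galois groups is an isomorphism (of
profinite groups); we express this by the existence of an isomorphism of topological
groups between `G_K` and `G_k`. -/
theorem absGaloisGroup_iso_residue_of_henselian_divisible
    (p : ℕ) [Fact p.Prime] (K : Type*) [Field K] [CharZero K]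
    (v : ValuationSubring K) (hhens : HenselianLocalRing v)
    -- the value group of `v` is divisible
    (hdiv : ∀ (x : Kˣ) (n : ℕ), 0 < n → ∃ y : Kˣ, v.valuation (y : K) ^ n = v.valuation (x : K))
    -- the residue field `k` of `v` is a relatively algebraically closed subfield of a
    -- finite extension of `ℚ_p`
    (hres : ∃ (E : Type) (fE : Field E),
      letI := fE
      ∃ aE : Algebra ℚ_[p] E,
        letI := aE
        FiniteDimensional ℚ_[p] E ∧
          ∃ ι : IsLocalRing.ResidueField v →+* E,
            ∀ x : E, (∃ q : Polynomial (IsLocalRing.ResidueField v),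
                q ≠ 0 ∧ Polynomial.eval₂ ι x q = 0) → x ∈ ι.range) :
    ∃ e : (AlgebraicClosure K ≃ₐ[K] AlgebraicClosure K) ≃*
        (AlgebraicClosure (IsLocalRing.ResidueField v) ≃ₐ[IsLocalRing.ResidueField v]
          AlgebraicClosure (IsLocalRing.ResidueField v)),
      Continuous e ∧ Continuous e.symm := by
  obtain ⟨E, fE, aE, -, ι, -⟩ := hres
  have : CharZero E := charZero_of_injective_algebraMap (algebraMap ℚ_[p] E).injective
  have : CharZero (IsLocalRing.ResidueField v) :=
    ⟨fun a b hab => Nat.cast_injective (R := E) (by simpa using congrArg ι hab)⟩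
  exact hens_main _ v hhens hdiv
end
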